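/- Let r ≥ 3 be an integer, let ε₁, …, ε_{r−1} be nonzero real numbers, let a₂, …, a_{r−1} and b₂, …, b_{r−1} be real numbers, and let x₁, …, x_r be real numbers satisfying x₁ = x₂ = 0 and the recurrence x_{j+1} = a_j ε_j + b_j ε_j x_j − ε_{j−1}⁻¹ ε_j x_{j−1} for 2 ≤ j ≤ r−1. For 2 < s ≤ t < r let D(s, t) be the determinant of the tridiagonal matrix with diagonal entries b_s, b_{s+1}, …, b_t and with sub- and super-diagonal entries ε_s⁻¹, ε_{s+1}⁻¹, …, ε_{t−1}⁻¹, and set D(s, t) = 1 when s > t. Then for every j with 3 ≤ j ≤ r, x_j = Σ_{i=2}^{j−1} a_i · D(i+1, j−1) · ε_i ε_{i+1} ⋯ ε_{j−1}. -/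

import Mathlib

/-- `triDet b ε s t` is the determinant of the tridiagonal matrix with diagonal entries
`b s, b (s+1), …, b t` and sub- and super-diagonal entries `(ε s)⁻¹, …, (ε (t-1))⁻¹`
(in 1-based terms: `M_{kk} = b_{s+k-1}`, `M_{k,k+1} = M_{k+1,k} = (ε_{s+k-1})⁻¹`),
with the convention `triDet b ε s t = 1` when `s > t`. -/
noncomputable def triDet (b ε : ℕ → ℝ) (s t : ℕ) : ℝ :=
  if t < s then 1
  else Matrix.det (Matrix.of fun k l : Fin (t + 1 - s) =>
    if (k : ℕ) = (l : ℕ) then b (s + (k : ℕ))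
    else if (k : ℕ) + 1 = (l : ℕ) ∨ (l : ℕ) + 1 = (k : ℕ) then
      (ε (s + min (k : ℕ) (l : ℕ)))⁻¹
    else 0)

/-- The tridiagonal matrix of size `n` starting at index `s`. -/
noncomputable def triMat (b ε : ℕ → ℝ) (s n : ℕ) : Matrix (Fin n) (Fin n) ℝ :=
  Matrix.of fun k l : Fin n =>
    if (k : ℕ) = (l : ℕ) then b (s + (k : ℕ))
    else if (k : ℕ) + 1 = (l : ℕ) ∨ (l : ℕ) + 1 = (k : ℕ) then
      (ε (s + min (k : ℕ) (l : ℕ)))⁻¹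
    else 0

lemma triMat_rec (b ε : ℕ → ℝ) (s n : ℕ) :
    (triMat b ε s (n + 2)).det = b (s + n + 1) * (triMat b ε s (n + 1)).det
      - (ε (s + n))⁻¹ * (ε (s + n))⁻¹ * (triMat b ε s n).det := by
  have hminor : ((triMat b ε s (n + 2)).submatrix (Fin.last (n+1)).succAbove
      (Fin.last n).castSucc.succAbove).det = (ε (s + n))⁻¹ * (triMat b ε s n).det := by
    rw [Matrix.det_succ_column _ (Fin.last n), Fin.sum_univ_castSucc]
    rw [Finset.sum_eq_zero]
    · have h1 : (((triMat b ε s (n + 2)).submatrix (Fin.last (n+1)).succAbove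
          (Fin.last n).castSucc.succAbove).submatrix (Fin.last n).succAbove
          (Fin.last n).succAbove) = triMat b ε s n := by
        ext i j
        have : (Fin.last n).castSucc.succAbove j.castSucc = j.castSucc.castSucc := by
          apply Fin.succAbove_of_castSucc_lt
          simp [Fin.lt_def]
        simp [triMat, this]
      rw [h1]
      simp [triMat, ← two_mul]
    · intro i _
      have hi := i.isLt
      have h2 : (triMat b ε s (n + 2)) i.castSucc.castSucc (Fin.last (n+1)) = 0 := by
        simp only [triMat, Matrix.of_apply, Fin.val_castSucc, Fin.val_last]
        rw [if_neg (by omega), if_neg (by omega)]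
      simp [h2]
  rw [Matrix.det_succ_row _ (Fin.last (n+1)), Fin.sum_univ_castSucc, Fin.sum_univ_castSucc, hminor]
  rw [Finset.sum_eq_zero]
  · have h1 : ((triMat b ε s (n + 2)).submatrix (Fin.last (n+1)).succAbove
          (Fin.last (n+1)).succAbove) = triMat b ε s (n+1) := by
      ext i j
      simp [triMat]
    rw [h1]
    have h3 : (-1 : ℝ) ^ (n + 1 + n) = -1 := by
      rw [show n + 1 + n = 2 * n + 1 by ring]; simp [pow_succ]
    simp [triMat, ← two_mul, h3, add_assoc]
    ring
  · intro i _
    have hi := i.isLt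
    have h2 : (triMat b ε s (n + 2)) (Fin.last (n+1)) i.castSucc.castSucc = 0 := by
      simp only [triMat, Matrix.of_apply, Fin.val_castSucc, Fin.val_last]
      rw [if_neg (by omega), if_neg (by omega)]
    simp [h2]

lemma triDet_eq (b ε : ℕ → ℝ) (s t : ℕ) :
    triDet b ε s t = (triMat b ε s (t + 1 - s)).det := by
  unfold triDet
  split_ifs with h
  · have : t + 1 - s = 0 := by omega
    rw [this]; simp
  · rfl

lemma triDet_rec (b ε : ℕ → ℝ) (s t : ℕ) (h : s ≤ t + 1) :
    triDet b ε s (t + 2) = b (t + 2) * triDet b ε s (t + 1)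
      - (ε (t + 1))⁻¹ * (ε (t + 1))⁻¹ * triDet b ε s t := by
  obtain ⟨n, hn⟩ := Nat.exists_eq_add_of_le h
  simp only [triDet_eq]
  rw [show t + 2 + 1 - s = n + 2 by omega, show t + 1 + 1 - s = n + 1 by omega,
    show t + 1 - s = n by omega, triMat_rec, hn, show t + 2 = s + n + 1 by omega]

lemma tri_aux (r : ℕ) (ε a b x : ℕ → ℝ)
    (hε : ∀ i, 1 ≤ i → i ≤ r - 1 → ε i ≠ 0)
    (hx1 : x 1 = 0) (hx2 : x 2 = 0)
    (hrec : ∀ j, 2 ≤ j → j ≤ r - 1 →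
      x (j + 1) = a j * ε j + b j * ε j * x j - (ε (j - 1))⁻¹ * ε j * x (j - 1)) (m : ℕ) :
    m + 2 ≤ r → x (m + 2) = ∑ i ∈ Finset.Icc 2 (m + 1),
        a i * triDet b ε (i + 1) (m + 1) * ∏ k ∈ Finset.Icc i (m + 1), ε k := by
  induction m using Nat.strong_induction_on with
  | _ m ih =>
  intro hm
  match m, ih, hm with
  | 0, _, _ => simpa using hx2
  | 1, _, hm =>
    have := hrec 2 le_rfl (by omega)
    simp [hx1, hx2] at this
    simp [this, triDet]
  | m + 2, ih, hm =>
    have h0 := ih m (by omega) (by omega)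
    have h1 := ih (m + 1) (by omega) (by omega)
    have h := hrec (m + 3) (by omega) (by omega)
    have he := hε (m + 2) (by omega) (by omega)
    simp only [show m + 3 - 1 = m + 2 by omega] at h
    rw [show m + 2 + 2 = m + 3 + 1 by ring, h, h0, show m + 3 = m + 1 + 2 by ring, h1]
    simp only [show m + 2 + 1 = m + 3 by ring, show m + 1 + 2 = m + 3 by ring,
      show m + 1 + 1 = m + 2 by ring]
    rw [Finset.sum_Icc_succ_top (show 2 ≤ m + 2 + 1 by omega),
      Finset.sum_Icc_succ_top (show 2 ≤ m + 1 + 1 by omega),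
      Finset.sum_Icc_succ_top (show 2 ≤ m + 1 + 1 by omega)]
    have key : ∀ i ∈ Finset.Icc 2 (m + 1),
        a i * triDet b ε (i + 1) (m + 3) * ∏ k ∈ Finset.Icc i (m + 3), ε k =
        b (m + 3) * ε (m + 3) *
          (a i * triDet b ε (i + 1) (m + 2) * ∏ k ∈ Finset.Icc i (m + 2), ε k)
        - (ε (m + 2))⁻¹ * ε (m + 3) *
          (a i * triDet b ε (i + 1) (m + 1) * ∏ k ∈ Finset.Icc i (m + 1), ε k) := by
      intro i hi
      rw [Finset.mem_Icc] at hi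
      rw [triDet_rec b ε (i + 1) (m + 1) (by omega),
        Finset.prod_Icc_succ_top (show i ≤ m + 2 + 1 by omega),
        Finset.prod_Icc_succ_top (show i ≤ m + 1 + 1 by omega)]
      simp only [show m + 2 + 1 = m + 3 by ring, show m + 1 + 2 = m + 3 by ring,
        show m + 1 + 1 = m + 2 by ring]
      field_simp
    simp only [show m + 2 + 1 = m + 3 by ring, show m + 1 + 1 = m + 2 by ring]
    rw [Finset.sum_congr rfl key, Finset.sum_sub_distrib, ← Finset.mul_sum, ← Finset.mul_sum]
    have d1 : triDet b ε (m + 3) (m + 2) = 1 := by simp [triDet]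
    have d2 : triDet b ε (m + 3 + 1) (m + 3) = 1 := by simp [triDet]
    have d3 : triDet b ε (m + 3) (m + 3) = b (m + 3) := by
      rw [triDet_eq, show m + 3 + 1 - (m + 3) = 1 by omega]
      simp [triMat]
    have p : ∏ k ∈ Finset.Icc (m + 2) (m + 3), ε k = ε (m + 2) * ε (m + 3) := by
      rw [Finset.prod_Icc_succ_top (show m + 2 ≤ m + 2 + 1 by omega)]; simp
    rw [d1, d2, d3, p]
    simp
    ring

/-- Let `r ≥ 3`, `ε₁, …, ε_{r-1}` nonzero reals, `a₂, …, a_{r-1}`, `b₂, …, b_{r-1}` reals, and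
`x₁, …, x_r` reals with `x₁ = x₂ = 0` and `x_{j+1} = a_j ε_j + b_j ε_j x_j - ε_{j-1}⁻¹ ε_j x_{j-1}`
for `2 ≤ j ≤ r-1`. Then for `3 ≤ j ≤ r`,
`x_j = ∑_{i=2}^{j-1} a_i D(i+1, j-1) ε_i ε_{i+1} ⋯ ε_{j-1}`. -/
theorem tridiagonal_recurrence (r : ℕ) (hr : 3 ≤ r) (ε a b x : ℕ → ℝ)
    (hε : ∀ i, 1 ≤ i → i ≤ r - 1 → ε i ≠ 0)
    (hx1 : x 1 = 0) (hx2 : x 2 = 0)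
    (hrec : ∀ j, 2 ≤ j → j ≤ r - 1 →
      x (j + 1) = a j * ε j + b j * ε j * x j - (ε (j - 1))⁻¹ * ε j * x (j - 1)) :
    ∀ j, 3 ≤ j → j ≤ r →
      x j = ∑ i ∈ Finset.Icc 2 (j - 1),
        a i * triDet b ε (i + 1) (j - 1) * ∏ k ∈ Finset.Icc i (j - 1), ε k := by
  intro j hj hjr
  obtain ⟨m, rfl⟩ := Nat.exists_eq_add_of_le' (show 2 ≤ j by omega)
  exact tri_aux r ε a b x hε hx1 hx2 hrec m hjr
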